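/- Explore-then-exploit regret bound under accurate estimates (core of the bandit stochastic-follower theorem): Let z_1, …, z_T be a fixed (non-adaptively chosen) sequence of contexts, let f_1, …, f_T be i.i.d. follower types in {1, …, K} with distribution F, and suppose the K follower types have context-independent best-response functions b_i : X → A_f with induced best-response probabilities p(x, a) = P_{i∼F}(b_i(x) = a). Let E ⊆ X be finite and nonempty and let the leader utility be u : Z × X × A_f → [0,1]. Suppose the leader spends the first K·N rounds exploring (playing arbitrary strategies) and that the estimates p̂(x, a), which are functions of f_1, …, f_{K·N} only, satisfy: there is an event G, measurable with respect to (f_1, …, f_{K·N}), with P(G) ≥ 1 − 1/T, on which |p̂(x, a) − p(x, a)| ≤ ε for all x ∈ E and a ∈ A_f. In rounds t > K·N the leader plays greedily, x_t = π̂(z_t) ∈ argmax_{x ∈ E} Σ_{a ∈ A_f} p̂(x, a)·u(z_t, x, a). Then for every comparator policy ρ with ρ(z) ∈ E for all z: E[Σ_{t=1}^T u(z_t, ρ(z_t), b_{f_t}(ρ(z_t))) − u(z_t, x_t, b_{f_t}(x_t))] ≤ K·N + 2·|A_f|·T·ε + 1. -/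

import Mathlib

open Finset

lemma resample_aux {K T : ℕ} (q : Fin K → ℝ) (hq1 : ∑ i, q i = 1) (t : Fin T)
    (g : (Fin T → Fin K) → Fin K → ℝ)
    (hg : ∀ ω j, g (Function.update ω t j) = g ω) :
    ∑ ω : Fin T → Fin K, (∏ s, q (ω s)) * g ω (ω t)
      = ∑ ω : Fin T → Fin K, (∏ s, q (ω s)) * ∑ i, q i * g ω i := by
  have hW : ∀ (ω : Fin T → Fin K) (i : Fin K),
      (∏ s, q (Function.update ω t i s)) * q (ω t) = (∏ s, q (ω s)) * q i := by
    intro ω i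
    rw [← Finset.mul_prod_erase univ (fun s => q (Function.update ω t i s)) (mem_univ t),
      ← Finset.mul_prod_erase univ (fun s => q (ω s)) (mem_univ t)]
    have : ∏ s ∈ univ.erase t, q (Function.update ω t i s) = ∏ s ∈ univ.erase t, q (ω s) := by
      apply Finset.prod_congr rfl
      intro s hs
      rw [Function.update_of_ne (Finset.ne_of_mem_erase hs)]
    rw [this]
    simp only [Function.update_self]
    ring
  have h1 : ∑ ω : Fin T → Fin K, (∏ s, q (ω s)) * g ω (ω t)
      = ∑ y : (Fin T → Fin K) × Fin K, ((∏ s, q (y.1 s)) * q y.2) * g y.1 (y.1 t) := by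
    rw [Fintype.sum_prod_type]
    apply Finset.sum_congr rfl
    intro ω _
    dsimp only
    rw [← Finset.sum_mul, ← Finset.mul_sum, hq1, mul_one]
  have h2 : ∑ ω : Fin T → Fin K, (∏ s, q (ω s)) * ∑ i, q i * g ω i
      = ∑ y : (Fin T → Fin K) × Fin K, ((∏ s, q (y.1 s)) * q y.2) * g y.1 y.2 := by
    rw [Fintype.sum_prod_type]
    apply Finset.sum_congr rfl
    intro ω _
    rw [Finset.mul_sum]
    apply Finset.sum_congr rfl
    intro i _
    ring
  rw [h1, h2]
  have hinv : Function.Involutive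
      (fun y : (Fin T → Fin K) × Fin K => (Function.update y.1 t y.2, y.1 t)) := by
    rintro ⟨ω, i⟩
    simp
  apply Fintype.sum_equiv hinv.toPerm
  rintro ⟨ω, i⟩
  simp only [Function.Involutive.coe_toPerm]
  rw [hW, hg]


open scoped Classical in
/-- **Explore-then-exploit regret bound under accurate estimates** (core of the
bandit-feedback theorem for stochastic follower types).  The contexts `z : Fin T → Z` are
a fixed (non-adaptively chosen) sequence; the follower types are i.i.d. with distribution
`q` on `Fin K` (coordinates of `ω : Fin T → Fin K` under the product weight
`∏ t, q (ω t)`); the best responses `b i : X → Af` are context-independent, with induced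
best-response probabilities `p(x, a) = Σ_i 1{b_i(x) = a}·q i`; `E ⊆ X` is finite nonempty
and `u : Z × X × Af → [0,1]`.  The leader spends the first `K·N ≤ T` rounds exploring; the
estimates `phat`, the success event `G` (with probability at least `1 − 1/T`, on which
`|phat x a − p(x,a)| ≤ ε` for all `x ∈ E`, `a ∈ Af`), and the strategies played in rounds
`t ≥ K·N` depend only on the first `K·N` follower types; in those rounds the leader plays
greedily with respect to `phat` over `E`.  Then for every comparator policy `ρ` with
`ρ z ∈ E`, the expected regret satisfies
`E[Σ_t u(z_t, ρ(z_t), b_{f_t}(ρ(z_t))) − u(z_t, x_t, b_{f_t}(x_t))]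
  ≤ K·N + 2·|Af|·T·ε + 1`. -/
theorem stmt18 {Z X Af : Type*} [Fintype Af] [DecidableEq Af]
    (K N T : ℕ) (hKN : K * N ≤ T)
    (q : Fin K → ℝ) (hq0 : ∀ i, 0 ≤ q i) (hq1 : ∑ i, q i = 1)
    (b : Fin K → X → Af)
    (u : Z → X → Af → ℝ) (hu : ∀ z x a, u z x a ∈ Set.Icc (0 : ℝ) 1)
    (E : Finset X) (hE : E.Nonempty)
    (z : Fin T → Z)
    (phat : (Fin T → Fin K) → X → Af → ℝ)
    (hphat_past : ∀ ω ω', (∀ s : Fin T, (s : ℕ) < K * N → ω s = ω' s) → phat ω = phat ω')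
    (G : (Fin T → Fin K) → Prop)
    (hG_past : ∀ ω ω', (∀ s : Fin T, (s : ℕ) < K * N → ω s = ω' s) → (G ω ↔ G ω'))
    (ε : ℝ) (hε : 0 ≤ ε)
    (hG_prob : (1 : ℝ) - 1 / (T : ℝ) ≤ ∑ ω ∈ Finset.univ.filter G, ∏ t, q (ω t))
    (hG_acc : ∀ ω, G ω → ∀ x ∈ E, ∀ a,
      |phat ω x a - (∑ i, if b i x = a then q i else 0)| ≤ ε)
    (xplay : Fin T → (Fin T → Fin K) → X)
    (hxplay_past : ∀ t : Fin T, K * N ≤ (t : ℕ) →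
      ∀ ω ω', (∀ s : Fin T, (s : ℕ) < K * N → ω s = ω' s) → xplay t ω = xplay t ω')
    (hxplay_mem : ∀ t : Fin T, K * N ≤ (t : ℕ) → ∀ ω, xplay t ω ∈ E)
    (hxplay_greedy : ∀ t : Fin T, K * N ≤ (t : ℕ) → ∀ ω, ∀ x ∈ E,
      (∑ a, phat ω x a * u (z t) x a) ≤
        ∑ a, phat ω (xplay t ω) a * u (z t) (xplay t ω) a)
    (ρ : Z → X) (hρ : ∀ zz, ρ zz ∈ E) :
    (∑ ω : Fin T → Fin K, (∏ t, q (ω t)) *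
        (∑ t, (u (z t) (ρ (z t)) (b (ω t) (ρ (z t))) -
               u (z t) (xplay t ω) (b (ω t) (xplay t ω)))))
      ≤ (K : ℝ) * N + 2 * (Fintype.card Af) * T * ε + 1 := by
  have hW0 : ∀ ω : Fin T → Fin K, 0 ≤ ∏ t, q (ω t) :=
    fun ω => Finset.prod_nonneg fun t _ => hq0 _
  have hW1 : ∑ ω : Fin T → Fin K, ∏ t, q (ω t) = 1 := by
    have h := Finset.prod_univ_sum (fun _ : Fin T => (univ : Finset (Fin K))) (fun _ i => q i)
    simp only [hq1, Finset.prod_const_one, Fintype.piFinset_univ] at h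
    exact h.symm
  have hbad : ∑ ω : Fin T → Fin K, (∏ t, q (ω t)) * (if G ω then 0 else 1) ≤ 1 / (T : ℝ) := by
    have h := Finset.sum_filter_add_sum_filter_not univ G (fun ω : Fin T → Fin K => ∏ t, q (ω t))
    have h' : ∑ ω : Fin T → Fin K, (∏ t, q (ω t)) * (if G ω then (0:ℝ) else 1)
        = ∑ ω ∈ univ.filter (fun ω => ¬ G ω), ∏ t, q (ω t) := by
      rw [Finset.sum_filter]
      apply Finset.sum_congr rfl
      intro ω _
      by_cases hg : G ω <;> simp [hg]
    rw [h']
    linarith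
  have hpu : ∀ zz x, ∑ i, q i * u zz x (b i x)
      = ∑ a, (∑ i, if b i x = a then q i else 0) * u zz x a := by
    intro zz x
    simp only [Finset.sum_mul]
    rw [Finset.sum_comm]
    apply Finset.sum_congr rfl
    intro i _
    simp [ite_mul]
  have hdiff : ∀ ω, G ω → ∀ zz, ∀ x ∈ E,
      |∑ a, phat ω x a * u zz x a - ∑ i, q i * u zz x (b i x)| ≤ Fintype.card Af * ε := by
    intro ω hg zz x hx
    rw [hpu, ← Finset.sum_sub_distrib]
    refine (Finset.abs_sum_le_sum_abs _ _).trans ?_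
    have : ∀ a ∈ (univ : Finset Af), |phat ω x a * u zz x a
        - (∑ i, if b i x = a then q i else 0) * u zz x a| ≤ ε := by
      intro a _
      rw [← sub_mul, abs_mul, abs_of_nonneg (hu zz x a).1]
      exact (mul_le_of_le_one_right (abs_nonneg _) (hu zz x a).2).trans (hG_acc ω hg x hx a)
    refine (Finset.sum_le_sum this).trans ?_
    simp
  have hround : ∀ t : Fin T,
      ∑ ω : Fin T → Fin K, (∏ t, q (ω t)) * (u (z t) (ρ (z t)) (b (ω t) (ρ (z t))) -
               u (z t) (xplay t ω) (b (ω t) (xplay t ω)))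
      ≤ (if (t : ℕ) < K * N then (1:ℝ) else 0)
        + (2 * (Fintype.card Af) * ε + 1 / (T : ℝ)) := by
    intro t
    have hA : 0 ≤ 2 * (Fintype.card Af : ℝ) * ε := by positivity
    by_cases ht : (t : ℕ) < K * N
    · have h1 : ∑ ω : Fin T → Fin K, (∏ t, q (ω t)) * (u (z t) (ρ (z t)) (b (ω t) (ρ (z t))) -
               u (z t) (xplay t ω) (b (ω t) (xplay t ω))) ≤ 1 := by
        rw [← hW1]
        apply Finset.sum_le_sum
        intro ω _
        apply mul_le_of_le_one_right (hW0 ω)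
        linarith [(hu (z t) (ρ (z t)) (b (ω t) (ρ (z t)))).2,
          (hu (z t) (xplay t ω) (b (ω t) (xplay t ω))).1]
      have : 0 ≤ 1 / (T : ℝ) := by positivity
      rw [if_pos ht]
      linarith
    · have ht' : K * N ≤ (t : ℕ) := not_lt.mp ht
      rw [if_neg ht, zero_add]
      rw [resample_aux q hq1 t (fun ω i => u (z t) (ρ (z t)) (b i (ρ (z t))) -
               u (z t) (xplay t ω) (b i (xplay t ω)))]
      · calc _ ≤ ∑ ω : Fin T → Fin K, (∏ t, q (ω t)) *
              (2 * (Fintype.card Af) * ε + if G ω then 0 else 1) := by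
              apply Finset.sum_le_sum
              intro ω _
              apply mul_le_mul_of_nonneg_left _ (hW0 ω)
              by_cases hg : G ω
              · rw [if_pos hg]
                have e1 := abs_le.mp (hdiff ω hg (z t) (ρ (z t)) (hρ _))
                have e2 := abs_le.mp (hdiff ω hg (z t) _ (hxplay_mem t ht' ω))
                have e3 := hxplay_greedy t ht' ω (ρ (z t)) (hρ _)
                simp only [mul_sub, Finset.sum_sub_distrib]
                linarith [e1.1, e2.2]
              · rw [if_neg hg]
                have : ∑ i, q i * (u (z t) (ρ (z t)) (b i (ρ (z t))) -
                    u (z t) (xplay t ω) (b i (xplay t ω))) ≤ ∑ i, q i := by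
                  apply Finset.sum_le_sum
                  intro i _
                  apply mul_le_of_le_one_right (hq0 i)
                  linarith [(hu (z t) (ρ (z t)) (b i (ρ (z t)))).2,
                    (hu (z t) (xplay t ω) (b i (xplay t ω))).1]
                linarith
          _ ≤ _ := by
              simp only [mul_add, Finset.sum_add_distrib]
              rw [← Finset.sum_mul, hW1, one_mul]
              linarith
      · intro ω j
        have : xplay t (Function.update ω t j) = xplay t ω := by
          apply hxplay_past t ht'
          intro s hs
          apply Function.update_of_ne
          rintro rfl
          exact ht hs
        simp only [this]
  simp only [Finset.mul_sum]
  rw [Finset.sum_comm]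
  refine (Finset.sum_le_sum fun t _ => hround t).trans ?_
  rw [Finset.sum_add_distrib]
  have hc : ∑ t : Fin T, (if (t : ℕ) < K * N then (1:ℝ) else 0) = (K : ℝ) * N := by
    rw [Fin.sum_univ_eq_sum_range (fun n => if n < K * N then (1:ℝ) else 0) T,
      ← Finset.sum_filter]
    have : (range T).filter (fun n => n < K * N) = range (K * N) := by
      ext n
      simp only [Finset.mem_filter, Finset.mem_range]
      omega
    rw [this]
    simp
  have hT : (T : ℝ) * (1 / (T : ℝ)) ≤ 1 := by
    rw [mul_one_div]
    exact div_self_le_one _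
  rw [hc]
  simp only [Finset.sum_const, Finset.card_univ, Fintype.card_fin, nsmul_eq_mul, mul_add]
  linarith
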